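/- arXiv:1812.07253 — 3 statements merged into one kernel-verified Lean document; each statement's English description precedes it below -/
import Mathlib

section
/- Let a, b ∈ ℝ^d with 0 ≤ a ≤ b componentwise, let X ⊆ [a,b] be nonempty and normal in the box [a,b] (i.e., a ≤ x' ≤ x ≤ b componentwise and x ∈ X imply x' ∈ X), let Ξ ⊆ ℝ^q be convex, let φ : ℝ^d → ℝ be increasing (componentwise monotone) and ψ : ℝ^q → ℝ be convex. Define D = {(x, ξ) : x ∈ X, ξ ∈ Ξ, φ(x) + ψ(ξ) ≤ 0}. If D contains at least two distinct points, then D has no isolated points, i.e., every point (x, ξ) ∈ D belongs to the closure of D \ {(x, ξ)}. -/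
/-- A point of a nontrivial convex subset of `S` is not isolated in `S`. -/
theorem Convex.mem_closure_diff_singleton {E : Type*} [AddCommGroup E] [Module ℝ E]
    [TopologicalSpace E] [ContinuousAdd E] [ContinuousSMul ℝ E] {C S : Set E}
    (hC : Convex ℝ C) (hCS : C ⊆ S) {p r : E} (hp : p ∈ C) (hr : r ∈ C) (hpr : p ≠ r) :
    p ∈ closure (S \ {p}) := by
  have hsub : openSegment ℝ p r ⊆ S \ {p} := fun z hz =>
    ⟨hCS (hC.openSegment_subset hp hr hz), fun h =>
      hpr (left_mem_openSegment_iff.1 (Set.mem_singleton_iff.1 h ▸ hz))⟩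
  exact closure_mono hsub (segment_subset_closure_openSegment (left_mem_segment ℝ p r))

/-- For `0 ≤ a ≤ b`, `X ⊆ [a,b]` nonempty and normal in the box `[a,b]`,
`Ξ` convex, `φ` increasing and `ψ` convex, the set
`D = {(x, ξ) : x ∈ X, ξ ∈ Ξ, φ(x) + ψ(ξ) ≤ 0}` has no isolated points whenever it
contains at least two distinct points. -/
theorem stmt_3 {d q : ℕ} (a b : Fin d → ℝ) (ha : 0 ≤ a) (hab : a ≤ b)
    (X : Set (Fin d → ℝ)) (hXsub : X ⊆ Set.Icc a b) (hXne : X.Nonempty)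
    (hnormal : ∀ x' x : Fin d → ℝ, a ≤ x' → x' ≤ x → x ≤ b → x ∈ X → x' ∈ X)
    (Ξ : Set (Fin q → ℝ)) (hΞ : Convex ℝ Ξ)
    (φ : (Fin d → ℝ) → ℝ) (hφ : Monotone φ)
    (ψ : (Fin q → ℝ) → ℝ) (hψ : ConvexOn ℝ Set.univ ψ)
    (htwo : ∃ p₁ ∈ {p : (Fin d → ℝ) × (Fin q → ℝ) | p.1 ∈ X ∧ p.2 ∈ Ξ ∧ φ p.1 + ψ p.2 ≤ 0},
            ∃ p₂ ∈ {p : (Fin d → ℝ) × (Fin q → ℝ) | p.1 ∈ X ∧ p.2 ∈ Ξ ∧ φ p.1 + ψ p.2 ≤ 0},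
            p₁ ≠ p₂) :
    ∀ p ∈ {p : (Fin d → ℝ) × (Fin q → ℝ) | p.1 ∈ X ∧ p.2 ∈ Ξ ∧ φ p.1 + ψ p.2 ≤ 0},
      p ∈ closure
        ({p : (Fin d → ℝ) × (Fin q → ℝ) | p.1 ∈ X ∧ p.2 ∈ Ξ ∧ φ p.1 + ψ p.2 ≤ 0} \ {p}) := by
  have hconv : ∀ y : Fin d → ℝ,
      Convex ℝ (Set.Icc a y ×ˢ (Ξ ∩ {ξ | ψ ξ ≤ -φ y})) := fun y =>
    (convex_Icc a y).prod (hΞ.inter (by simpa using hψ.convex_le (-φ y)))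
  have hsub : ∀ y ∈ X, Set.Icc a y ×ˢ (Ξ ∩ {ξ | ψ ξ ≤ -φ y}) ⊆
      {p : (Fin d → ℝ) × (Fin q → ℝ) | p.1 ∈ X ∧ p.2 ∈ Ξ ∧ φ p.1 + ψ p.2 ≤ 0} := by
    rintro y hy ⟨x, ξ⟩ ⟨⟨hax, hxy⟩, hξ, hψξ⟩
    refine ⟨hnormal x y hax hxy (hXsub hy).2 hy, hξ, ?_⟩
    have hφxy := hφ hxy
    change ψ ξ ≤ -φ y at hψξ
    dsimp only
    linarith
  rintro ⟨x, ξ⟩ ⟨hx, hξ, hxξ⟩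
  dsimp only at hx hξ hxξ
  have hax : a ≤ x := (hXsub hx).1
  by_cases hxa : x = a
  · subst hxa
    obtain ⟨⟨y, η⟩, ⟨hy, hη, hyη⟩, hne⟩ : ∃ r ∈ {p : (Fin d → ℝ) × (Fin q → ℝ) |
        p.1 ∈ X ∧ p.2 ∈ Ξ ∧ φ p.1 + ψ p.2 ≤ 0}, (x, ξ) ≠ r := by
      obtain ⟨p₁, hp₁, p₂, hp₂, hne⟩ := htwo
      by_cases h : (x, ξ) = p₁
      · exact ⟨p₂, hp₂, h ▸ hne⟩
      · exact ⟨p₁, hp₁, h⟩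
    dsimp only at hy hη hyη
    have hxy : x ≤ y := (hXsub hy).1
    have hφxy := hφ hxy
    by_cases hηξ : η = ξ
    · subst hηξ
      exact (hconv y).mem_closure_diff_singleton (hsub y hy) (r := (y, η))
        ⟨⟨le_rfl, hxy⟩, hη, le_neg_iff_add_nonpos_left.2 hyη⟩
        ⟨⟨hxy, le_rfl⟩, hη, le_neg_iff_add_nonpos_left.2 hyη⟩ hne
    · exact (hconv x).mem_closure_diff_singleton (hsub x hx) (r := (x, η))
        ⟨⟨le_rfl, le_rfl⟩, hξ, le_neg_iff_add_nonpos_left.2 hxξ⟩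
        ⟨⟨le_rfl, le_rfl⟩, hη, show ψ η ≤ -φ x by linarith⟩
        fun h => hηξ (Prod.mk.inj h).2.symm
  · exact (hconv x).mem_closure_diff_singleton (hsub x hx) (r := (a, ξ))
      ⟨⟨hax, le_rfl⟩, hξ, le_neg_iff_add_nonpos_left.2 hxξ⟩
      ⟨⟨le_rfl, hax⟩, hξ, le_neg_iff_add_nonpos_left.2 hxξ⟩
      fun h => hxa (Prod.mk.inj h).1
end

section
/- Let ε > 0, γ ∈ ℝ, and m ≥ 1. Let M = [p,q] ⊆ ℝ^d be a box, let g_1⁻, …, g_m⁻ : ℝ^d → ℝ, and let x̄* ∈ M be a common maximizer of g_1⁻, …, g_m⁻ over M. Let g_1⁺, …, g_m⁺ : ℝ^d × ℝ^q → ℝ, let C ⊆ ℝ^d × ℝ^q, and let f⁺, f⁻ : ℝ^d × ℝ^q → ℝ with f⁻(x, ξ) > 0 for all (x, ξ) ∈ C. Suppose every (x, ξ) ∈ C with x ∈ M and γ·f⁻(x, ξ) − f⁺(x, ξ) ≤ 0 satisfies max_{i=1,…,m} ( g_i⁺(x, ξ) − g_i⁻(x̄*) ) > −ε (the bounding problem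 over M has optimal value greater than −ε). Then there exists no (x, ξ) ∈ C with x ∈ M such that f⁺(x, ξ)/f⁻(x, ξ) ≥ γ and g_i⁺(x, ξ) − g_i⁻(x) ≤ −ε for all i = 1, …, m; i.e., no ε-essential feasible point with x ∈ M has objective value at least γ. -/
/-- Maximum of finitely many reals indexed by `Fin m`, `m > 0`. -/
noncomputable def maxFin {m : ℕ} (hm : 0 < m) (v : Fin m → ℝ) : ℝ :=
  Finset.univ.sup' ⟨⟨0, hm⟩, Finset.mem_univ _⟩ v

/-- Let `x̄*` be a common maximizer of `g_1⁻, …, g_m⁻` over the box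
`M = [p,q]` and suppose the bounding problem over `M` has optimal value greater than
`-ε`, i.e., every `(x,ξ) ∈ C` with `x ∈ M` and `γ·f⁻(x,ξ) − f⁺(x,ξ) ≤ 0` satisfies
`max_i (g_i⁺(x,ξ) − g_i⁻(x̄*)) > −ε`. Then there is no `(x,ξ) ∈ C` with `x ∈ M`,
objective value `f⁺(x,ξ)/f⁻(x,ξ) ≥ γ`, and `g_i⁺(x,ξ) − g_i⁻(x) ≤ −ε` for all `i`. -/
theorem stmt_9 {d q m : ℕ} (hm : 0 < m) (ε γ : ℝ) (hε : 0 < ε)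
    (p qv : Fin d → ℝ)
    (gminus : Fin m → (Fin d → ℝ) → ℝ)
    (xstar : Fin d → ℝ) (hxstar : xstar ∈ Set.Icc p qv)
    (hmax : ∀ i, ∀ x ∈ Set.Icc p qv, gminus i x ≤ gminus i xstar)
    (gplus : Fin m → (Fin d → ℝ) × (Fin q → ℝ) → ℝ)
    (C : Set ((Fin d → ℝ) × (Fin q → ℝ)))
    (fplus fminus : (Fin d → ℝ) × (Fin q → ℝ) → ℝ)
    (hpos : ∀ z ∈ C, 0 < fminus z)
    (hbound : ∀ z ∈ C, z.1 ∈ Set.Icc p qv → γ * fminus z - fplus z ≤ 0 →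
      -ε < maxFin hm (fun i => gplus i z - gminus i xstar)) :
    ¬ ∃ z ∈ C, z.1 ∈ Set.Icc p qv ∧ γ ≤ fplus z / fminus z ∧
        ∀ i, gplus i z - gminus i z.1 ≤ -ε := by
  rintro ⟨z, hzC, hzM, hobj, hfeas⟩
  have hγ := (le_div_iff₀ (hpos z hzC)).mp hobj
  refine (hbound z hzC hzM (sub_nonpos.mpr hγ)).not_ge (Finset.sup'_le _ _ fun i _ => ?_)
  exact (sub_le_sub_left (hmax i z.1 hzM) _).trans (hfeas i)
end

section
/- Let m ≥ 1, let Ξ ⊆ ℝ^q and let Y ⊆ ℝ^d be nonempty. Let A_1, …, A_m : ℝ^q → ℝ, B_1, …, B_m : ℝ^d → ℝ, c : ℝ^q → ℝ, and d : ℝ^d → ℝ. Let x* ∈ Y be a common minimizer over Y of d and of all the B_i, i.e., d(x*) ≤ d(x) and B_i(x*) ≤ B_i(x) for every x ∈ Y and every i. Then the optimal values of the following two problems coincide: (1) minimize max_{i=1,…,m} ( A_i(ξ) + B_i(x) ) over ξ ∈ Ξ and x ∈ Y subject to c(ξ) + d(x) ≤ 0; and (2) minimize max_{i=1,…,m} (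 A_i(ξ) + B_i(x*) ) over ξ ∈ Ξ subject to c(ξ) + d(x*) ≤ 0. In particular, problem (1) is feasible if and only if problem (2) is feasible, and the infimum of the objective value set of (1) equals that of (2). -/
theorem maxFin_mono {m : ℕ} (hm : 0 < m) {v w : Fin m → ℝ} (h : ∀ i, v i ≤ w i) :
    maxFin hm v ≤ maxFin hm w :=
  Finset.sup'_mono_fun fun i _ => h i

/-- Passing to a subset that is coinitial does not change the infimum, also when the sets
are empty or unbounded below. -/
theorem Real.sInf_eq_of_subset_of_forall_exists_le {S T : Set ℝ} (hTS : T ⊆ S)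
    (h : ∀ s ∈ S, ∃ t ∈ T, t ≤ s) : sInf S = sInf T := by
  rcases S.eq_empty_or_nonempty with rfl | hS
  · rw [Set.subset_empty_iff.mp hTS]
  have hT : T.Nonempty := by
    obtain ⟨s, hs⟩ := hS
    obtain ⟨t, ht, -⟩ := h s hs
    exact ⟨t, ht⟩
  by_cases hb : BddBelow T
  · have hbS : BddBelow S := by
      obtain ⟨b, hb⟩ := hb
      refine ⟨b, fun s hs => ?_⟩
      obtain ⟨t, ht, hts⟩ := h s hs
      exact (hb ht).trans hts
    refine le_antisymm (csInf_le_csInf hbS hT hTS) (le_csInf hS fun s hs => ?_)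
    obtain ⟨t, ht, hts⟩ := h s hs
    exact (csInf_le hb ht).trans hts
  · rw [Real.sInf_of_not_bddBelow hb, Real.sInf_of_not_bddBelow fun hS => hb (hS.mono hTS)]

/-- If `x*` is a common minimizer over `Y` of `d` and of all the `B_i`,
then the problem `min_{ξ∈Ξ, x∈Y, c(ξ)+d(x)≤0} max_i (A_i(ξ)+B_i(x))` has the same
feasibility status and the same optimal value as the reduced problem
`min_{ξ∈Ξ, c(ξ)+d(x*)≤0} max_i (A_i(ξ)+B_i(x*))`. -/
theorem stmt_10 {d q m : ℕ} (hm : 0 < m)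
    (Ξ : Set (Fin q → ℝ)) (Y : Set (Fin d → ℝ)) (hYne : Y.Nonempty)
    (A : Fin m → (Fin q → ℝ) → ℝ) (B : Fin m → (Fin d → ℝ) → ℝ)
    (c : (Fin q → ℝ) → ℝ) (dd : (Fin d → ℝ) → ℝ)
    (xstar : Fin d → ℝ) (hxstar : xstar ∈ Y)
    (hmin : ∀ x ∈ Y, dd xstar ≤ dd x ∧ ∀ i, B i xstar ≤ B i x) :
    (({v : ℝ | ∃ ξ ∈ Ξ, ∃ x ∈ Y, c ξ + dd x ≤ 0 ∧
        v = maxFin hm (fun i => A i ξ + B i x)}).Nonempty ↔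
      ({v : ℝ | ∃ ξ ∈ Ξ, c ξ + dd xstar ≤ 0 ∧
        v = maxFin hm (fun i => A i ξ + B i xstar)}).Nonempty) ∧
    sInf {v : ℝ | ∃ ξ ∈ Ξ, ∃ x ∈ Y, c ξ + dd x ≤ 0 ∧
        v = maxFin hm (fun i => A i ξ + B i x)} =
      sInf {v : ℝ | ∃ ξ ∈ Ξ, c ξ + dd xstar ≤ 0 ∧
        v = maxFin hm (fun i => A i ξ + B i xstar)} := by
  have hsub : {v : ℝ | ∃ ξ ∈ Ξ, c ξ + dd xstar ≤ 0 ∧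
        v = maxFin hm (fun i => A i ξ + B i xstar)} ⊆
      {v : ℝ | ∃ ξ ∈ Ξ, ∃ x ∈ Y, c ξ + dd x ≤ 0 ∧
        v = maxFin hm (fun i => A i ξ + B i x)} := by
    rintro v ⟨ξ, hξ, hc, hv⟩
    exact ⟨ξ, hξ, xstar, hxstar, hc, hv⟩
  have hle : ∀ s ∈ {v : ℝ | ∃ ξ ∈ Ξ, ∃ x ∈ Y, c ξ + dd x ≤ 0 ∧
        v = maxFin hm (fun i => A i ξ + B i x)},
      ∃ t ∈ {v : ℝ | ∃ ξ ∈ Ξ, c ξ + dd xstar ≤ 0 ∧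
        v = maxFin hm (fun i => A i ξ + B i xstar)}, t ≤ s := by
    rintro s ⟨ξ, hξ, x, hx, hc, rfl⟩
    exact ⟨_, ⟨ξ, hξ, by linarith [(hmin x hx).1], rfl⟩,
      maxFin_mono hm fun i => by linarith [(hmin x hx).2 i]⟩
  refine ⟨⟨fun ⟨s, hs⟩ => ?_, fun hT => hT.mono hsub⟩,
    Real.sInf_eq_of_subset_of_forall_exists_le hsub hle⟩
  obtain ⟨t, ht, -⟩ := hle s hs
  exact ⟨t, ht⟩
end
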